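/- arXiv:1902.02319 — 2 statements merged into one kernel-verified Lean document; each statement's English description precedes it below -/
import Mathlib

section
/- There exists an absolute constant C > 0 such that for every lacunary sequence Λ = (λ_j)_{j∈ℕ₀} of positive integers with ratio ρ_Λ ∈ (1,2) and every f ∈ H¹_A(𝕋), one has (Σ_{j∈ℕ₀} |f̂(λ_j)|²)^{1/2} ≤ C (ρ_Λ − 1)^{-1/2} ‖f‖_{L¹(𝕋)}. -/
open MeasureTheory Real Complex
open scoped ENNReal

noncomputable section

instance : Fact (0 < 2 * π) := ⟨by positivity⟩

/-- The torus `ℝ/(2πℤ)`. -/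
abbrev Tor := AddCircle (2 * π)

/-- The normalized Haar measure `(2π)⁻¹ dx` on the torus. -/
def haarT : Measure Tor := AddCircle.haarAddCircle

/-- The ratio `ρ_Λ = inf_j Λ(j+1)/Λ(j)` of a sequence `Λ`. -/
def ratio (Λ : ℕ → ℕ) : ℝ := ⨅ j : ℕ, (Λ (j+1) : ℝ) / (Λ j : ℝ)

/-- The span of the characters of the torus of frequency at least `m`. -/
def highFreq (m : ℤ) : Submodule ℂ C(Tor, ℂ) :=
  Submodule.span ℂ ((fun n : ℤ => (fourier n : C(Tor, ℂ))) '' Set.Ici m)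

lemma fourier_mem_highFreq {m n : ℤ} (h : m ≤ n) : (fourier n : C(Tor, ℂ)) ∈ highFreq m :=
  Submodule.subset_span ⟨n, h, rfl⟩

lemma highFreq_anti {m n : ℤ} (h : m ≤ n) : highFreq n ≤ highFreq m :=
  Submodule.span_mono (Set.image_mono (Set.Ici_subset_Ici.2 h))

lemma mul_mem_highFreq {m n : ℤ} {p q : C(Tor, ℂ)} (hp : p ∈ highFreq m) (hq : q ∈ highFreq n) :
    p * q ∈ highFreq (m + n) := by
  have h := Submodule.mul_mem_mul hp hq
  rw [highFreq, highFreq, Submodule.span_mul_span] at h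
  refine Submodule.span_mono ?_ h
  rintro _ ⟨_, ⟨a, ha, rfl⟩, _, ⟨b, hb, rfl⟩, rfl⟩
  refine ⟨a + b, Set.mem_Ici.2 (add_le_add ha hb), ?_⟩
  ext x
  simp

instance : IsProbabilityMeasure haarT :=
  inferInstanceAs (IsProbabilityMeasure AddCircle.haarAddCircle)

lemma integrable_continuousMap_mul {f : Tor → ℂ} (hf : Integrable f haarT) (q : C(Tor, ℂ)) :
    Integrable (fun x => q x * f x) haarT :=
  hf.bdd_mul q.continuous.aestronglyMeasurable (c := ‖q‖) (.of_forall q.norm_coe_le_norm)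

lemma integral_fourier_mul (f : Tor → ℂ) (n : ℤ) :
    ∫ x, (fourier n : C(Tor, ℂ)) x * f x ∂haarT = fourierCoeff f (-n) := by
  simp [fourierCoeff, haarT]

lemma integral_mul_eq_zero_of_mem_highFreq {f : Tor → ℂ} (hf : Integrable f haarT)
    (h0 : ∀ n : ℤ, n < 0 → fourierCoeff f n = 0) {q : C(Tor, ℂ)} (hq : q ∈ highFreq 1) :
    ∫ x, q x * f x ∂haarT = 0 := by
  induction hq using Submodule.span_induction with
  | mem q h =>
    obtain ⟨n, hn, rfl⟩ := h
    rw [integral_fourier_mul]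
    have : 1 ≤ n := hn
    exact h0 _ (by omega)
  | zero => simp
  | add p q _ _ hp hq =>
    simp only [ContinuousMap.add_apply, add_mul]
    rw [integral_add (integrable_continuousMap_mul hf p) (integrable_continuousMap_mul hf q),
      hp, hq, add_zero]
  | smul c q _ hq =>
    simp only [ContinuousMap.smul_apply, smul_eq_mul, mul_assoc]
    rw [integral_const_mul, hq, mul_zero]

lemma norm_quadratic_le (w g : ℂ) (hg : ‖g‖ ≤ 1) :
    ‖(1 - (‖w‖ : ℂ) ^ 2) * g + w - starRingEnd ℂ w * g ^ 2‖ ≤ 1 + ‖w‖ ^ 2 := by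
  suffices h : 2 * ‖(1 - (‖w‖ : ℂ) ^ 2) * g + w - starRingEnd ℂ w * g ^ 2‖ ≤
      (1 + ‖w‖ ^ 2) * (1 + ‖g‖ ^ 2) by
    nlinarith [sq_nonneg ‖w‖, norm_nonneg g, mul_nonneg (sq_nonneg ‖w‖) (norm_nonneg g),
      mul_le_mul_of_nonneg_left (pow_le_one₀ (n := 2) (norm_nonneg g) hg)
        (by positivity : (0 : ℝ) ≤ 1 + ‖w‖ ^ 2)]
  refine le_of_sq_le_sq ?_ (by positivity)
  rw [mul_pow, ← Complex.ofReal_pow, ← Complex.normSq_eq_norm_sq, ← Complex.normSq_eq_norm_sq,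
    ← Complex.normSq_eq_norm_sq]
  obtain ⟨a, b⟩ := w
  obtain ⟨x, y⟩ := g
  simp only [Complex.normSq_apply, Complex.add_re, Complex.sub_re, Complex.mul_re, Complex.add_im,
    Complex.sub_im, Complex.mul_im, Complex.one_re, Complex.one_im, Complex.ofReal_re,
    Complex.ofReal_im, Complex.conj_re, Complex.conj_im, pow_two]
  nlinarith [sq_nonneg ((1 - (a * a + b * b)) * (1 - (x * x + y * y)) - 4 * (a * x + b * y))]

lemma damped_step_le {t s x l : ℝ} (ht : 0 ≤ t) (hs : 0 ≤ s) (hx : 0 ≤ x)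
    (hsx : t ^ 2 * (s + x) ≤ 1 / 2) (hl : t * (s - 2 * t ^ 2 * s ^ 2) ≤ l) :
    t * ((s + x) - 2 * t ^ 2 * (s + x) ^ 2) ≤ ((1 - t ^ 2 * x) * l + t * x) / (1 + t ^ 2 * x) := by
  have ha : 0 ≤ t ^ 2 * x := by positivity
  have hA : 0 ≤ t ^ 2 * s := by positivity
  rw [le_div_iff₀ (by positivity)]
  have h1 := mul_le_mul_of_nonneg_left hl (by nlinarith : 0 ≤ 1 - t ^ 2 * x)
  refine le_trans ?_ (add_le_add_left h1 _)
  have key : (1 - t ^ 2 * x) * (t * (s - 2 * t ^ 2 * s ^ 2)) + t * x -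
      t * ((s + x) - 2 * t ^ 2 * (s + x) ^ 2) * (1 + t ^ 2 * x) =
      t * x * ((t ^ 2 * x) + 2 * (t ^ 2 * s) + 4 * (t ^ 2 * s) ^ 2 +
        4 * (t ^ 2 * s) * (t ^ 2 * x) + 2 * (t ^ 2 * x) ^ 2) := by ring
  have : 0 ≤ t * x * ((t ^ 2 * x) + 2 * (t ^ 2 * s) + 4 * (t ^ 2 * s) ^ 2 +
        4 * (t ^ 2 * s) * (t ^ 2 * x) + 2 * (t ^ 2 * x) ^ 2) := by positivity
  linarith

/-- Riesz-type construction of a bounded trigonometric polynomial testing the coefficients of `f`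
along a sequence growing faster than powers of two. -/
lemma exists_test_polynomial {μ : ℕ → ℕ} (hμ0 : 0 < μ 0) (hμ : ∀ j, 2 * μ j < μ (j + 1))
    {f : Tor → ℂ} (hf : Integrable f haarT) (h0 : ∀ n : ℤ, n < 0 → fourierCoeff f n = 0)
    {t : ℝ} (ht : 0 ≤ t) (N : ℕ)
    (hN : t ^ 2 * ∑ j ∈ Finset.range N, ‖fourierCoeff f (μ j : ℤ)‖ ^ 2 ≤ 1 / 2) :
    ∃ (m : ℤ) (q : C(Tor, ℂ)) (l : ℝ), 0 < (μ N : ℤ) + 2 * m ∧ q ∈ highFreq m ∧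
      (∀ x, ‖q x‖ ≤ 1) ∧ ∫ x, q x * f x ∂haarT = l ∧
      t * ((∑ j ∈ Finset.range N, ‖fourierCoeff f (μ j : ℤ)‖ ^ 2) -
        2 * t ^ 2 * (∑ j ∈ Finset.range N, ‖fourierCoeff f (μ j : ℤ)‖ ^ 2) ^ 2) ≤ l := by
  induction N with
  | zero => exact ⟨0, 0, 0, by simpa using hμ0, Submodule.zero_mem _, by simp, by simp, by simp⟩
  | succ k ih =>
    rw [Finset.sum_range_succ] at hN ⊢
    set s := ∑ j ∈ Finset.range k, ‖fourierCoeff f (μ j : ℤ)‖ ^ 2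
    set z := fourierCoeff f (μ k : ℤ) with hz
    have hs : 0 ≤ s := Finset.sum_nonneg fun _ _ => by positivity
    obtain ⟨m, q, l, hm, hq, hb, hL, hl⟩ :=
      ih (le_trans (mul_le_mul_of_nonneg_left (by simp) (by positivity)) hN)
    set r : ℝ := t ^ 2 * ‖z‖ ^ 2
    have hr0 : 0 ≤ r := by positivity
    have hr1 : (1 + r : ℂ) ≠ 0 := by
      have : (1 + r : ℝ) ≠ 0 := by positivity
      exact_mod_cast this
    set e : C(Tor, ℂ) := fourier (-(μ k : ℤ))
    set e' : C(Tor, ℂ) := fourier (μ k : ℤ)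
    set c : ℂ := t * starRingEnd ℂ z with hc
    set q' : C(Tor, ℂ) := ((1 + r : ℂ)⁻¹) • ((1 - r : ℂ) • q + c • e
      - (starRingEnd ℂ c) • (e' * (q * q)))
    have hq2 : e' * (q * q) ∈ highFreq (μ k + (m + m)) :=
      mul_mem_highFreq (fourier_mem_highFreq le_rfl) (mul_mem_highFreq hq hq)
    refine ⟨-(μ k : ℤ), q', ((1 - r) * l + t * ‖z‖ ^ 2) / (1 + r), ?_, ?_, ?_, ?_, ?_⟩
    · have := hμ k
      omega
    · refine Submodule.smul_mem _ _ (Submodule.sub_mem _ (Submodule.add_mem _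
        (Submodule.smul_mem _ _ (highFreq_anti (by omega) hq))
        (Submodule.smul_mem _ _ (fourier_mem_highFreq le_rfl)))
        (Submodule.smul_mem _ _ (highFreq_anti (by omega) hq2)))
    · intro x
      have hw : ‖c * e x‖ ^ 2 = r := by
        have : ‖e x‖ = 1 := Circle.norm_coe _
        rw [norm_mul, this, hc, norm_mul, RCLike.norm_conj, Complex.norm_real, mul_one, mul_pow,
          Real.norm_eq_abs, sq_abs]
      have he : starRingEnd ℂ (e x) = e' x := by
        simp only [e, e', fourier_neg, Complex.conj_conj]
      have h := norm_quadratic_le (c * e x) (q x) (hb x)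
      rw [← Complex.ofReal_pow, hw, map_mul, he] at h
      have h1 : ‖(1 + r : ℂ)‖ = 1 + r := by
        rw [← Complex.ofReal_one, ← Complex.ofReal_add, Complex.norm_real,
          Real.norm_of_nonneg (by positivity)]
      have h2 : q' x = (1 + r : ℂ)⁻¹ * ((1 - r) * q x + c * e x
          - starRingEnd ℂ c * e' x * q x ^ 2) := by
        simp only [q', ContinuousMap.smul_apply, ContinuousMap.sub_apply, ContinuousMap.add_apply,
          ContinuousMap.mul_apply, smul_eq_mul]
        ring
      rw [h2, norm_mul, norm_inv, h1]
      exact inv_mul_le_one_of_le₀ h (by positivity)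
    · have hI := integrable_continuousMap_mul hf
      have h1 : ∀ x, q' x * f x = (1 + r : ℂ)⁻¹ * ((1 - r) * (q x * f x) + c * (e x * f x)
          - starRingEnd ℂ c * ((e' * (q * q)) x * f x)) := by
        intro x
        simp only [q', ContinuousMap.smul_apply, ContinuousMap.sub_apply, ContinuousMap.add_apply,
          smul_eq_mul]
        ring
      have h2 : c * z = (t * ‖z‖ ^ 2 : ℝ) := by
        rw [hc, mul_assoc, Complex.conj_mul']
        push_cast
        rfl
      simp_rw [h1]
      rw [integral_const_mul, integral_sub (by exact ((hI q).const_mul _).add ((hI e).const_mul _))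
        ((hI _).const_mul _), integral_add ((hI q).const_mul _) ((hI e).const_mul _),
        integral_const_mul, integral_const_mul, integral_const_mul, hL,
        integral_mul_eq_zero_of_mem_highFreq hf h0 (highFreq_anti (by omega) hq2),
        integral_fourier_mul, neg_neg, ← hz, h2]
      push_cast
      field_simp
      ring
    · exact damped_step_le ht hs (by positivity) hN hl

/-- Paley's inequality for sequences growing faster than powers of two. -/
lemma sum_sq_fourierCoeff_le {μ : ℕ → ℕ} (hμ0 : 0 < μ 0) (hμ : ∀ j, 2 * μ j < μ (j + 1))
    {f : Tor → ℂ} (hf : Integrable f haarT) (h0 : ∀ n : ℤ, n < 0 → fourierCoeff f n = 0) (N : ℕ) :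
    ∑ j ∈ Finset.range N, ‖fourierCoeff f (μ j : ℤ)‖ ^ 2 ≤ 16 * (∫ x, ‖f x‖ ∂haarT) ^ 2 := by
  set s := ∑ j ∈ Finset.range N, ‖fourierCoeff f (μ j : ℤ)‖ ^ 2 with hs
  have hs0 : 0 ≤ s := Finset.sum_nonneg fun _ _ => by positivity
  rcases hs0.eq_or_lt with h | hpos
  · rw [← h]
    positivity
  have hsq := Real.sqrt_pos.2 hpos
  have hss : √s ^ 2 = s := Real.sq_sqrt hs0
  have ht2 : (1 / (2 * √s)) ^ 2 * s = 1 / 4 := by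
    rw [div_pow, mul_pow, hss]
    field_simp
    norm_num
  obtain ⟨m, q, l, -, -, hb, hL, hl⟩ := exists_test_polynomial hμ0 hμ hf h0
    (t := 1 / (2 * √s)) (by positivity) N (by rw [ht2]; norm_num)
  have hle : l ≤ ∫ x, ‖f x‖ ∂haarT := by
    calc l ≤ ‖(l : ℂ)‖ := by rw [Complex.norm_real]; exact le_abs_self l
      _ ≤ ∫ x, ‖f x‖ ∂haarT := by
        rw [← hL]
        refine norm_integral_le_of_norm_le hf.norm (.of_forall fun x => ?_)
        rw [norm_mul]
        exact mul_le_of_le_one_left (norm_nonneg _) (hb x)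
  have h4 : √s / 4 ≤ l := by
    refine le_trans (le_of_eq ?_) hl
    rw [← hs]
    have : s - 2 * (1 / (2 * √s)) ^ 2 * s ^ 2 = √s ^ 2 / 2 := by
      rw [hss]
      linear_combination (-2 * s) * ht2
    rw [this]
    field_simp
    norm_num
  nlinarith

lemma ratio_mul_le {Λ : ℕ → ℕ} (hpos : ∀ j, 0 < Λ j) (j : ℕ) :
    ratio Λ * Λ j ≤ Λ (j + 1) := by
  have hj : (0 : ℝ) < Λ j := by exact_mod_cast hpos j
  rw [← le_div_iff₀ hj]
  exact ciInf_le ⟨0, by rintro _ ⟨i, rfl⟩; positivity⟩ j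

lemma ratio_pow_mul_le {Λ : ℕ → ℕ} (hpos : ∀ j, 0 < Λ j) (hr : 0 ≤ ratio Λ) (j M : ℕ) :
    ratio Λ ^ M * Λ j ≤ Λ (j + M) := by
  induction M with
  | zero => simp
  | succ M ih =>
    calc ratio Λ ^ (M + 1) * Λ j = ratio Λ * (ratio Λ ^ M * Λ j) := by ring
      _ ≤ ratio Λ * Λ (j + M) := by gcongr
      _ ≤ Λ (j + (M + 1)) := ratio_mul_le hpos (j + M)

lemma sum_range_mul_eq_sum_residues (g : ℕ → ℝ) (M N : ℕ) :
    ∑ n ∈ Finset.range (M * N), g n =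
      ∑ i ∈ Finset.range M, ∑ j ∈ Finset.range N, g (i + M * j) := by
  induction N with
  | zero => simp
  | succ N ih =>
    rw [Nat.mul_succ, Finset.sum_range_add, ih]
    simp_rw [Finset.sum_range_succ, Finset.sum_add_distrib, add_comm (M * N)]

/-- Paley's inequality with explicit dependence on the lacunarity constant: there is an
absolute constant `C > 0` such that for every lacunary sequence `Λ` of positive integers
with ratio `ρ_Λ ∈ (1,2)` and every `f ∈ H¹_A(𝕋)`,
`(Σ_j |f̂(λ_j)|²)^{1/2} ≤ C (ρ_Λ - 1)^{-1/2} ‖f‖_{L¹}`. -/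
theorem statement6 :
    ∃ C : ℝ, 0 < C ∧
      ∀ (Λ : ℕ → ℕ), StrictMono Λ → 0 < Λ 0 →
      1 < ratio Λ → ratio Λ < 2 →
      ∀ f : Tor → ℂ, Integrable f haarT →
        (∀ n : ℤ, n < 0 → fourierCoeff f n = 0) →
        Real.sqrt (∑' j : ℕ, ‖fourierCoeff f (Λ j : ℤ)‖ ^ 2) ≤
          C * (ratio Λ - 1) ^ (-(1:ℝ)/2) * ∫ x, ‖f x‖ ∂haarT := by
  refine ⟨7, by norm_num, fun Λ hΛ hΛ0 h1 h2 f hf h0 => ?_⟩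
  set ρ := ratio Λ
  set I := ∫ x, ‖f x‖ ∂haarT
  have hI : 0 ≤ I := integral_nonneg fun _ => norm_nonneg _
  have hpos : ∀ j, 0 < Λ j := fun j => hΛ0.trans_le (hΛ.monotone (Nat.zero_le j))
  have hδ : 0 < ρ - 1 := sub_pos.2 h1
  set M := ⌈2 / (ρ - 1)⌉₊
  have hM : 2 / (ρ - 1) ≤ M := Nat.le_ceil _
  have hM0 : 0 < M := Nat.ceil_pos.2 (by positivity)
  have hM3 : (M : ℝ) ≤ 3 / (ρ - 1) := by
    have h : (M : ℝ) < 2 / (ρ - 1) + 1 := Nat.ceil_lt_add_one (by positivity)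
    have h' : 1 ≤ 1 / (ρ - 1) := by
      rw [le_div_iff₀ hδ]
      linarith
    have : 3 / (ρ - 1) = 2 / (ρ - 1) + 1 / (ρ - 1) := by ring
    linarith
  have hρM : 3 ≤ ρ ^ M := by
    have h := one_add_mul_le_pow (a := ρ - 1) (by linarith) M
    rw [div_le_iff₀ hδ] at hM
    rw [add_sub_cancel] at h
    linarith
  have hgrow : ∀ n, 2 * Λ n < Λ (n + M) := by
    intro n
    have h := ratio_pow_mul_le hpos (by linarith) n M
    have hn : (0 : ℝ) < Λ n := by exact_mod_cast hpos n
    have : (2 * Λ n : ℝ) < Λ (n + M) := by nlinarith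
    exact_mod_cast this
  have hsum : ∀ n, ∑ j ∈ Finset.range n, ‖fourierCoeff f (Λ j : ℤ)‖ ^ 2 ≤
      49 * (ρ - 1)⁻¹ * I ^ 2 := by
    intro n
    calc ∑ j ∈ Finset.range n, ‖fourierCoeff f (Λ j : ℤ)‖ ^ 2
        ≤ ∑ j ∈ Finset.range (M * n), ‖fourierCoeff f (Λ j : ℤ)‖ ^ 2 :=
          Finset.sum_le_sum_of_subset_of_nonneg
            (Finset.range_mono (Nat.le_mul_of_pos_left n hM0)) fun _ _ _ => by positivity
      _ = ∑ i ∈ Finset.range M, ∑ j ∈ Finset.range n,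
            ‖fourierCoeff f (Λ (i + M * j) : ℤ)‖ ^ 2 :=
          sum_range_mul_eq_sum_residues (fun k => ‖fourierCoeff f (Λ k : ℤ)‖ ^ 2) M n
      _ ≤ ∑ _i ∈ Finset.range M, 16 * I ^ 2 :=
          Finset.sum_le_sum fun i _ => sum_sq_fourierCoeff_le (μ := fun j => Λ (i + M * j))
            (hpos _) (fun j => by simpa only [Nat.mul_succ, add_assoc] using hgrow (i + M * j)) hf h0 n
      _ = M * (16 * I ^ 2) := by simp
      _ ≤ 3 / (ρ - 1) * (16 * I ^ 2) := by gcongr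
      _ ≤ 49 * (ρ - 1)⁻¹ * I ^ 2 := by
          have : 0 ≤ (ρ - 1)⁻¹ * I ^ 2 := by positivity
          rw [div_eq_mul_inv]
          linarith
  refine Real.sqrt_le_iff.2 ⟨by positivity, ?_⟩
  refine (Real.tsum_le_of_sum_range_le (fun _ => by positivity) hsum).trans (le_of_eq ?_)
  have hp : ((ρ - 1) ^ (-(1 : ℝ) / 2)) ^ 2 = (ρ - 1)⁻¹ := by
    rw [← Real.rpow_natCast, ← Real.rpow_mul hδ.le, ← Real.rpow_neg_one]
    norm_num
  rw [mul_pow, mul_pow, hp]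
  norm_num

end
end

section
/- For every d ∈ ℕ there exists a constant C_d > 0, depending only on d, such that for all lacunary sequences Λ₁ = (λ^{(1)}_{j})_{j∈ℕ₀}, …, Λ_d = (λ^{(d)}_{j})_{j∈ℕ₀} of positive integers with ratios ρ_{Λ_nₙ} ∈ (1,2) for n = 1,…,d, and every f ∈ H¹_A(𝕋^d), one has (Σ_{j₁,…,j_d ∈ ℕ₀} |f̂(λ^{(1)}_{j₁},…,λ^{(d)}_{j_d})|²)^{1/2} ≤ C_d (Π_{n=1}^d (ρ_{Λ_n} − 1)^{-1/2}) ‖f‖_{L¹(𝕋^d)}. -/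
open MeasureTheory Real Complex
open scoped ENNReal BigOperators

noncomputable section

/-- The normalized Haar (product) measure `(2π)^{-d} dx` on the `d`-torus. -/
def haarTd (d : ℕ) : Measure (Fin d → Tor) :=
  Measure.pi fun _ => (AddCircle.haarAddCircle : Measure Tor)

/-- The Fourier coefficient `f̂(n₁,…,n_d) = (2π)^{-d}∫ f(x) e^{-i(n₁x₁+⋯+n_dx_d)} dx`
of a function on the `d`-torus. -/
def fourierCoeffPi {d : ℕ} (f : (Fin d → Tor) → ℂ) (n : Fin d → ℤ) : ℂ :=
  ∫ x : Fin d → Tor, (∏ k, fourier (-(n k)) (x k)) * f x ∂(haarTd d)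

/-- The normalized Haar measure on the circle. -/
local notation "μT" => (AddCircle.haarAddCircle : Measure Tor)

theorem fourier_one_pow (n : ℕ) (x : Tor) : (fourier 1 x : ℂ) ^ n = fourier (n : ℤ) x := by
  rw [fourier_one, fourier_apply, natCast_zsmul, AddCircle.toCircle_nsmul, Circle.coe_pow]

theorem norm_fourier_apply (n : ℤ) (x : Tor) : ‖(fourier n x : ℂ)‖ = 1 := by
  rw [fourier_apply]; exact Circle.norm_coe _

theorem integral_fourier (n : ℤ) : ∫ x, (fourier n x : ℂ) ∂μT = if n = 0 then 1 else 0 := by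
  have h := congrFun (fourierCoeff_fourier (T := 2 * π) n) 0
  simp only [fourierCoeff, neg_zero, fourier_zero, one_smul] at h
  rw [h, Pi.single_apply]
  simp [eq_comm]

theorem integral_fourier_neg_mul_eval (p : Polynomial ℂ) (n : ℕ) :
    ∫ x, (fourier (-(n : ℤ)) x : ℂ) * p.eval (fourier 1 x : ℂ) ∂μT = p.coeff n := by
  have h : ∀ x : Tor, (fourier (-(n : ℤ)) x : ℂ) * p.eval (fourier 1 x : ℂ)
      = ∑ m ∈ Finset.range (p.natDegree + 1), p.coeff m * (fourier ((m : ℤ) - n) x : ℂ) := by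
    intro x
    rw [Polynomial.eval_eq_sum_range, Finset.mul_sum]
    refine Finset.sum_congr rfl fun m _ => ?_
    rw [fourier_one_pow, sub_eq_add_neg, fourier_add]
    ring
  simp_rw [h]
  rw [integral_finsetSum]
  · simp_rw [integral_const_mul, integral_fourier, sub_eq_zero, Nat.cast_inj]
    simp only [mul_ite, mul_one, mul_zero, Finset.sum_ite_eq', Finset.mem_range, ite_eq_left_iff]
    intro h
    exact (Polynomial.coeff_eq_zero_of_natDegree_lt (by omega)).symm
  · intro m _
    exact (Continuous.integrable_of_hasCompactSupport (by fun_prop)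
      (HasCompactSupport.of_compactSpace _))

theorem norm_coeff_le_of_norm_eval_le (p : Polynomial ℂ) (n : ℕ) {M : ℝ}
    (h : ∀ x : Tor, ‖p.eval (fourier 1 x : ℂ)‖ ≤ M) : ‖p.coeff n‖ ≤ M := by
  rw [← integral_fourier_neg_mul_eval]
  refine (norm_integral_le_of_norm_le_const (C := M) (ae_of_all _ fun x => ?_)).trans ?_
  · rw [norm_mul, norm_fourier_apply, one_mul]; exact h x
  · simp

theorem sum_sq_norm_coeff_eq_integral (p : Polynomial ℂ) {N : ℕ} (hN : p.natDegree < N) :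
    ∑ m ∈ Finset.range N, ‖p.coeff m‖ ^ 2 = ∫ x, ‖p.eval (fourier 1 x : ℂ)‖ ^ 2 ∂μT := by
  have h : ∀ x : Tor, ((‖p.eval (fourier 1 x : ℂ)‖ ^ 2 : ℝ) : ℂ)
      = ∑ m ∈ Finset.range N, starRingEnd ℂ (p.coeff m) *
          ((fourier (-(m : ℤ)) x : ℂ) * p.eval (fourier 1 x : ℂ)) := by
    intro x
    push_cast
    rw [← Complex.conj_mul']
    conv_lhs => rw [Polynomial.eval_eq_sum_range' hN]
    rw [map_sum, Finset.sum_mul]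
    refine Finset.sum_congr rfl fun m _ => ?_
    rw [map_mul, fourier_one_pow, fourier_neg]
    conv_rhs => rw [Polynomial.eval_eq_sum_range' hN]
    ring
  have hc : ((∑ m ∈ Finset.range N, ‖p.coeff m‖ ^ 2 : ℝ) : ℂ)
      = ((∫ x, ‖p.eval (fourier 1 x : ℂ)‖ ^ 2 ∂μT : ℝ) : ℂ) := by
    rw [← integral_complex_ofReal]
    simp_rw [h]
    rw [integral_finsetSum]
    · simp_rw [integral_const_mul, integral_fourier_neg_mul_eval]
      push_cast
      exact Finset.sum_congr rfl fun m _ => (Complex.conj_mul' _).symm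
    · intro m _
      exact (Continuous.integrable_of_hasCompactSupport (by fun_prop)
        (HasCompactSupport.of_compactSpace _))
  exact_mod_cast hc

theorem exists_polynomial_approx_exp (R : ℝ) {η : ℝ} (hη : 0 < η) :
    ∃ T : Polynomial ℂ, ∀ s : ℂ, ‖s‖ ≤ R → ‖T.eval s - Complex.exp s‖ ≤ η := by
  have hR := Real.summable_pow_div_factorial R
  have h := tendstoUniformlyOn_tsum_nat (f := fun n (s : ℂ) => s ^ n / (n.factorial : ℂ))
    (s := {s : ℂ | ‖s‖ ≤ R}) hR (by
      intro n s hs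
      rw [norm_div, norm_pow, Complex.norm_natCast]
      gcongr
      exact hs)
  rw [Metric.tendstoUniformlyOn_iff] at h
  obtain ⟨N, hN⟩ := (h η hη).exists
  refine ⟨∑ n ∈ Finset.range N, Polynomial.C ((n.factorial : ℂ)⁻¹) * Polynomial.X ^ n,
    fun s hs => ?_⟩
  simp only [Polynomial.eval_finsetSum, Polynomial.eval_mul, Polynomial.eval_C,
    Polynomial.eval_pow, Polynomial.eval_X]
  have := (hN s hs).le
  rw [dist_comm, dist_eq_norm] at this
  rwa [← congrFun (NormedSpace.exp_eq_tsum_div (𝔸 := ℂ)) s, ← Complex.exp_eq_exp_ℂ,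
    Finset.sum_congr rfl fun n _ => div_eq_inv_mul (s ^ n) (n.factorial : ℂ)] at this

theorem exists_analytic_add_conj {g : C(Tor, ℂ)}
    (hg : g ∈ Submodule.span ℂ (Set.range (@fourier (2 * π)))) :
    ∃ P Q : Polynomial ℂ, ∀ x : Tor,
      g x = P.eval (fourier 1 x : ℂ) + starRingEnd ℂ (Q.eval (fourier 1 x : ℂ)) := by
  induction hg using Submodule.span_induction with
  | mem g hg =>
    obtain ⟨n, rfl⟩ := hg
    rcases Int.eq_nat_or_neg n with ⟨m, rfl | rfl⟩
    · exact ⟨Polynomial.X ^ m, 0, fun x => by simp [fourier_one_pow, -fourier_apply]⟩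
    · refine ⟨0, Polynomial.X ^ m, fun x => ?_⟩
      rw [Polynomial.eval_pow, Polynomial.eval_X, fourier_one_pow, fourier_neg]
      simp
  | zero => exact ⟨0, 0, fun x => by simp⟩
  | add g₁ g₂ _ _ h₁ h₂ =>
    obtain ⟨P₁, Q₁, h₁⟩ := h₁
    obtain ⟨P₂, Q₂, h₂⟩ := h₂
    refine ⟨P₁ + P₂, Q₁ + Q₂, fun x => ?_⟩
    rw [ContinuousMap.add_apply, h₁, h₂, Polynomial.eval_add, Polynomial.eval_add, map_add]
    ring
  | smul c g _ h =>
    obtain ⟨P, Q, h⟩ := h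
    refine ⟨Polynomial.C c * P, Polynomial.C (starRingEnd ℂ c) * Q, fun x => ?_⟩
    rw [ContinuousMap.smul_apply, h]
    simp only [Polynomial.eval_mul, Polynomial.eval_C, map_mul, Complex.conj_conj, smul_eq_mul]
    ring

theorem exists_polynomial_re_approx {u : Tor → ℝ} (hu : Continuous u) {η : ℝ} (hη : 0 < η) :
    ∃ P : Polynomial ℂ, ∀ x : Tor, |(P.eval (fourier 1 x : ℂ)).re - u x| ≤ η := by
  let U : C(Tor, ℂ) := ⟨fun x => (u x : ℂ), by fun_prop⟩
  have hU : U ∈ (Submodule.span ℂ (Set.range (@fourier (2 * π)))).topologicalClosure := by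
    rw [span_fourier_closure_eq_top]; trivial
  rw [← SetLike.mem_coe, Submodule.topologicalClosure_coe, Metric.mem_closure_iff] at hU
  obtain ⟨g, hg, hd⟩ := hU η hη
  obtain ⟨P, Q, hPQ⟩ := exists_analytic_add_conj hg
  refine ⟨P + Q, fun x => ?_⟩
  have h1 : ‖g x - U x‖ ≤ η := by
    rw [← dist_eq_norm, dist_comm]
    exact (ContinuousMap.dist_apply_le_dist x).trans hd.le
  have h2 := (Complex.abs_re_le_norm _).trans h1
  rw [hPQ x] at h2
  simpa [U] using h2

/-- Up to a factor arbitrarily close to `1`, a positive continuous weight on the circle is the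
squared modulus of an analytic polynomial which has an approximate analytic inverse. -/
theorem exists_approx_outer {w : Tor → ℝ} (hw : Continuous w) (hpos : ∀ x, 0 < w x)
    {η : ℝ} (hη : 0 < η) :
    ∃ q r : Polynomial ℂ, ∀ x : Tor,
      ‖(q * r).eval (fourier 1 x : ℂ) - 1‖ ≤ 2 * η + η ^ 2 ∧
      ‖q.eval (fourier 1 x : ℂ)‖ ^ 2 ≤ ((1 + η) * Real.exp η) ^ 2 * w x ∧
      ‖r.eval (fourier 1 x : ℂ)‖ ^ 2 * w x ≤ ((1 + η) * Real.exp η) ^ 2 := by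
  have hu : Continuous fun x => Real.log (w x) / 2 :=
    (hw.log fun x => (hpos x).ne').div_const _
  obtain ⟨P, hP⟩ := exists_polynomial_re_approx hu hη
  have hPc : Continuous fun x : Tor => ‖P.eval (fourier 1 x : ℂ)‖ := by fun_prop
  obtain ⟨R, hR⟩ := (isCompact_range hPc).bddAbove
  have hR : ∀ x : Tor, ‖P.eval (fourier 1 x : ℂ)‖ ≤ R := fun x => hR ⟨x, rfl⟩
  obtain ⟨T, hT⟩ := exists_polynomial_approx_exp R (mul_pos hη (Real.exp_pos (-R)))
  have key : ∀ s : ℂ, ‖s‖ ≤ R → ‖T.eval s * Complex.exp (-s) - 1‖ ≤ η := by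
    intro s hs
    have h1 : T.eval s * Complex.exp (-s) - 1 = (T.eval s - Complex.exp s) * Complex.exp (-s) := by
      rw [sub_mul, ← Complex.exp_add, add_neg_cancel, Complex.exp_zero]
    rw [h1, norm_mul, Complex.norm_exp]
    have h2 : Real.exp (-s).re ≤ Real.exp R :=
      Real.exp_le_exp.2 ((Complex.re_le_norm _).trans (by rwa [norm_neg]))
    calc _ ≤ (η * Real.exp (-R)) * Real.exp R :=
          mul_le_mul (hT s hs) h2 (Real.exp_pos _).le (by positivity)
      _ = η := by rw [mul_assoc, ← Real.exp_add]; simp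
  have key' : ∀ s : ℂ, ‖s‖ ≤ R → ‖T.eval s‖ ≤ (1 + η) * Real.exp s.re := by
    intro s hs
    have h1 : T.eval s = ((T.eval s * Complex.exp (-s) - 1) + 1) * Complex.exp s := by
      rw [sub_add_cancel, mul_assoc, ← Complex.exp_add, neg_add_cancel, Complex.exp_zero, mul_one]
    rw [h1, norm_mul, Complex.norm_exp]
    gcongr
    refine (norm_add_le _ _).trans ?_
    rw [norm_one, add_comm]
    gcongr
    exact key s hs
  refine ⟨T.comp P, T.comp (-P), fun x => ?_⟩
  set s := P.eval (fourier 1 x : ℂ) with hs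
  have hsR : ‖s‖ ≤ R := hR x
  have hsR' : ‖-s‖ ≤ R := by rwa [norm_neg]
  have hw2 : w x = Real.exp (Real.log (w x) / 2) ^ 2 := by
    rw [← Real.exp_nat_mul]
    push_cast
    rw [mul_div_cancel₀ _ two_ne_zero, Real.exp_log (hpos x)]
  have hPx := abs_le.1 (hP x)
  simp only [Polynomial.eval_mul, Polynomial.eval_comp, Polynomial.eval_neg, ← hs]
  refine ⟨?_, ?_, ?_⟩
  · set a := T.eval s * Complex.exp (-s) - 1 with ha
    set b := T.eval (-s) * Complex.exp (- -s) - 1 with hb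
    have hab : T.eval s * T.eval (-s) - 1 = a + b + a * b := by
      have : Complex.exp (-s) * Complex.exp (- -s) = 1 := by
        rw [← Complex.exp_add]; simp
      rw [ha, hb]
      linear_combination (-(T.eval s * T.eval (-s))) * this
    have h1 := key s hsR
    have h2 := key (-s) hsR'
    rw [hab]
    calc ‖a + b + a * b‖ ≤ ‖a‖ + ‖b‖ + ‖a‖ * ‖b‖ := by
          refine (norm_add_le _ _).trans ?_
          rw [norm_mul]
          gcongr
          exact norm_add_le _ _
      _ ≤ η + η + η * η := by gcongr
      _ = _ := by ring
  · rw [hw2, ← mul_pow]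
    refine pow_le_pow_left₀ (norm_nonneg _) ((key' s hsR).trans ?_) 2
    rw [mul_assoc, ← Real.exp_add]
    gcongr
    linarith [hPx.2]
  · rw [hw2, ← mul_pow]
    refine pow_le_pow_left₀ (by positivity) ?_ 2
    refine (mul_le_mul_of_nonneg_right (key' (-s) hsR') (Real.exp_pos _).le).trans ?_
    rw [mul_assoc, ← Real.exp_add]
    gcongr
    rw [Complex.neg_re]
    linarith [hPx.1]

theorem ratio_pow_mul_le_s7 {Λ : ℕ → ℕ} (hΛ : StrictMono Λ) (h0 : 0 < Λ 0) (h1 : 1 < ratio Λ)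
    (a t : ℕ) : ratio Λ ^ t * Λ a ≤ Λ (a + t) := by
  have hpos : ∀ j, (0 : ℝ) < Λ j := fun j =>
    Nat.cast_pos.2 (h0.trans_le (hΛ.monotone (Nat.zero_le j)))
  have hbdd : BddBelow (Set.range fun j : ℕ => (Λ (j+1) : ℝ) / (Λ j : ℝ)) :=
    ⟨0, by rintro _ ⟨j, rfl⟩; exact div_nonneg (hpos _).le (hpos _).le⟩
  induction t with
  | zero => simp
  | succ t ih =>
    have h := (le_div_iff₀ (hpos (a + t))).1 (ciInf_le hbdd (a + t))
    calc ratio Λ ^ (t + 1) * Λ a = ratio Λ * (ratio Λ ^ t * Λ a) := by ring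
      _ ≤ ratio Λ * Λ (a + t) := by gcongr
      _ ≤ _ := h

theorem card_lacunary_le {Λ : ℕ → ℕ} (hΛ : StrictMono Λ) (h0 : 0 < Λ 0) (h1 : 1 < ratio Λ)
    (h2 : ratio Λ < 2) (m L : ℕ) :
    (((Finset.range L).filter fun j => m ≤ Λ j ∧ Λ j ≤ 2 * m).card : ℝ) ≤ 2 / (ratio Λ - 1) := by
  set S := (Finset.range L).filter fun j => m ≤ Λ j ∧ Λ j ≤ 2 * m with hS
  have hρ : 0 < ratio Λ - 1 := by linarith
  rcases S.eq_empty_or_nonempty with h | h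
  · rw [h]; simp only [Finset.card_empty, Nat.cast_zero]; positivity
  set a := S.min' h
  set b := S.max' h
  have ha := (Finset.mem_filter.1 (S.min'_mem h)).2.1
  have hb := (Finset.mem_filter.1 (S.max'_mem h)).2.2
  obtain ⟨t, ht⟩ := Nat.exists_eq_add_of_le (S.min'_le _ (S.max'_mem h))
  have hcard : S.card ≤ t + 1 := by
    have : S ⊆ Finset.Icc a b := fun j hj => Finset.mem_Icc.2 ⟨S.min'_le _ hj, S.le_max' _ hj⟩
    have := Finset.card_le_card this
    rw [Nat.card_Icc] at this
    have : b = a + t := ht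
    omega
  have hpow := ratio_pow_mul_le_s7 hΛ h0 h1 a t
  have hapos : (0 : ℝ) < Λ a := Nat.cast_pos.2 (h0.trans_le (hΛ.monotone (Nat.zero_le _)))
  have hle : (Λ (a + t) : ℝ) ≤ 2 * Λ a := by
    rw [← ht]
    exact_mod_cast hb.trans (Nat.mul_le_mul_left 2 ha)
  have h3 : ratio Λ ^ t ≤ 2 := le_of_mul_le_mul_right (hpow.trans hle) hapos
  have h4 := one_add_mul_sub_le_pow (show -1 ≤ ratio Λ by linarith) t
  rw [le_div_iff₀ hρ]
  have h5 : (S.card : ℝ) ≤ t + 1 := by exact_mod_cast hcard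
  nlinarith

theorem sq_sum_antidiagonal_half_le (a b : ℕ → ℝ) {l N : ℕ} (hl : l < N) :
    (∑ x ∈ Finset.HasAntidiagonal.antidiagonal l, if l ≤ 2 * x.1 then a x.1 * b x.2 else 0) ^ 2 ≤
      (∑ p ∈ Finset.range N, if p ≤ l ∧ l ≤ 2 * p then a p ^ 2 else 0) *
        ∑ r ∈ Finset.range N, b r ^ 2 := by
  rw [← Finset.sum_filter, ← Finset.sum_filter]
  refine (Finset.sum_mul_sq_le_sq_mul_sq _ _ _).trans ?_
  refine mul_le_mul ?_ ?_ (Finset.sum_nonneg fun _ _ => sq_nonneg _)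
    (Finset.sum_nonneg fun _ _ => sq_nonneg _)
  · rw [← Finset.sum_image (f := fun p => a p ^ 2) (g := Prod.fst)]
    · refine Finset.sum_le_sum_of_subset_of_nonneg ?_ fun _ _ _ => sq_nonneg _
      intro p hp
      simp only [Finset.mem_image, Finset.mem_filter, Finset.HasAntidiagonal.mem_antidiagonal,
        Prod.exists,
        exists_and_right, exists_eq_right] at hp
      obtain ⟨⟨r, h1⟩, h2⟩ := hp
      simp only [Finset.mem_filter, Finset.mem_range]
      omega
    · rintro ⟨p, r⟩ hx ⟨p', r'⟩ hy h
      simp only [Finset.coe_filter, Finset.HasAntidiagonal.mem_antidiagonal,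
        Set.mem_ofPred_eq] at hx hy h
      ext <;> simp <;> omega
  · rw [← Finset.sum_image (f := fun p => b p ^ 2) (g := Prod.snd)]
    · refine Finset.sum_le_sum_of_subset_of_nonneg ?_ fun _ _ _ => sq_nonneg _
      intro r hr
      simp only [Finset.mem_image, Finset.mem_filter, Finset.HasAntidiagonal.mem_antidiagonal,
        Prod.exists,
        exists_eq_right] at hr
      obtain ⟨p, h1, h2⟩ := hr
      simp only [Finset.mem_range]
      omega
    · rintro ⟨p, r⟩ hx ⟨p', r'⟩ hy h
      simp only [Finset.coe_filter, Finset.HasAntidiagonal.mem_antidiagonal,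
        Set.mem_ofPred_eq] at hx hy h
      ext <;> simp <;> omega

theorem sq_sum_antidiagonal_le {a b : ℕ → ℝ} (ha : ∀ n, 0 ≤ a n) (hb : ∀ n, 0 ≤ b n)
    {l N : ℕ} (hl : l < N) :
    (∑ x ∈ Finset.HasAntidiagonal.antidiagonal l, a x.1 * b x.2) ^ 2 ≤
      2 * ((∑ p ∈ Finset.range N, if p ≤ l ∧ l ≤ 2 * p then a p ^ 2 else 0) *
        ∑ r ∈ Finset.range N, b r ^ 2) +
      2 * ((∑ r ∈ Finset.range N, if r ≤ l ∧ l ≤ 2 * r then b r ^ 2 else 0) *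
        ∑ p ∈ Finset.range N, a p ^ 2) := by
  have h1 := sq_sum_antidiagonal_half_le a b hl
  have h2 := sq_sum_antidiagonal_half_le b a hl
  rw [← Finset.Nat.sum_antidiagonal_swap] at h2
  simp only [Prod.fst_swap, Prod.snd_swap] at h2
  have h3 : ∑ x ∈ Finset.HasAntidiagonal.antidiagonal l, a x.1 * b x.2 ≤
      (∑ x ∈ Finset.HasAntidiagonal.antidiagonal l, if l ≤ 2 * x.1 then a x.1 * b x.2 else 0) +
      ∑ x ∈ Finset.HasAntidiagonal.antidiagonal l, if l ≤ 2 * x.2 then b x.2 * a x.1 else 0 := by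
    rw [← Finset.sum_add_distrib]
    refine Finset.sum_le_sum fun x hx => ?_
    have hx := Finset.HasAntidiagonal.mem_antidiagonal.1 hx
    have hab := mul_nonneg (ha x.1) (hb x.2)
    split_ifs with h h'
    · nlinarith
    · simp
    · rw [mul_comm (b x.2)]; simp
    · omega
  have h4 : 0 ≤ ∑ x ∈ Finset.HasAntidiagonal.antidiagonal l, a x.1 * b x.2 :=
    Finset.sum_nonneg fun x _ => mul_nonneg (ha _) (hb _)
  refine (pow_le_pow_left₀ h4 h3 2).trans ?_
  refine add_sq_le.trans ?_
  rw [mul_add]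
  gcongr

theorem sum_sum_lacunary_le {Λ : ℕ → ℕ} (hΛ : StrictMono Λ) (h0 : 0 < Λ 0) (h1 : 1 < ratio Λ)
    (h2 : ratio Λ < 2) {c : ℕ → ℝ} (hc : ∀ n, 0 ≤ c n) (L N : ℕ) :
    ∑ j ∈ Finset.range L, ∑ p ∈ Finset.range N, (if p ≤ Λ j ∧ Λ j ≤ 2 * p then c p else 0) ≤
      2 / (ratio Λ - 1) * ∑ p ∈ Finset.range N, c p := by
  rw [Finset.sum_comm, Finset.mul_sum]
  refine Finset.sum_le_sum fun p _ => ?_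
  rw [← Finset.sum_filter, Finset.sum_const, nsmul_eq_mul]
  exact mul_le_mul_of_nonneg_right (card_lacunary_le hΛ h0 h1 h2 p L) (hc p)

theorem integrable_of_continuous_circle {E : Type*} [NormedAddCommGroup E] {g : Tor → E}
    (hg : Continuous g) : Integrable g μT :=
  hg.integrable_of_hasCompactSupport (HasCompactSupport.of_compactSpace _)

theorem sum_sq_coeff_mul_le {ι : Type*} [Fintype ι] {Λ : ℕ → ℕ} (hΛ : StrictMono Λ)
    (h0 : 0 < Λ 0) (h1 : 1 < ratio Λ) (h2 : ratio Λ < 2) (q : Polynomial ℂ)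
    (G : ι → Polynomial ℂ) (L : ℕ) :
    ∑ i, ∑ j ∈ Finset.range L, ‖(q * G i).coeff (Λ j)‖ ^ 2 ≤
      8 / (ratio Λ - 1) * (∫ x, ‖q.eval (fourier 1 x : ℂ)‖ ^ 2 ∂μT) *
        ∑ i, ∫ x, ‖(G i).eval (fourier 1 x : ℂ)‖ ^ 2 ∂μT := by
  rw [Finset.mul_sum]
  refine Finset.sum_le_sum fun i _ => ?_
  set N := q.natDegree + (G i).natDegree + Λ L + 1 with hN
  rw [← sum_sq_norm_coeff_eq_integral q (N := N) (by omega),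
    ← sum_sq_norm_coeff_eq_integral (G i) (N := N) (by omega)]
  set a : ℕ → ℝ := fun n => ‖q.coeff n‖ with ha
  set b : ℕ → ℝ := fun n => ‖(G i).coeff n‖ with hb
  set A := ∑ m ∈ Finset.range N, a m ^ 2
  set B := ∑ m ∈ Finset.range N, b m ^ 2
  have hA : 0 ≤ A := Finset.sum_nonneg fun _ _ => sq_nonneg _
  have hB : 0 ≤ B := Finset.sum_nonneg fun _ _ => sq_nonneg _
  have hj : ∀ j ∈ Finset.range L, ‖(q * G i).coeff (Λ j)‖ ^ 2 ≤
      2 * ((∑ p ∈ Finset.range N, if p ≤ Λ j ∧ Λ j ≤ 2 * p then a p ^ 2 else 0) * B) +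
      2 * ((∑ r ∈ Finset.range N, if r ≤ Λ j ∧ Λ j ≤ 2 * r then b r ^ 2 else 0) * A) := by
    intro j hj
    have hjN : Λ j < N := by
      have := hΛ (Finset.mem_range.1 hj)
      omega
    refine le_trans ?_ (sq_sum_antidiagonal_le (a := a) (b := b) (fun _ => norm_nonneg _)
      (fun _ => norm_nonneg _) hjN)
    refine pow_le_pow_left₀ (norm_nonneg _) ?_ 2
    rw [Polynomial.coeff_mul]
    refine (norm_sum_le _ _).trans (le_of_eq ?_)
    simp only [norm_mul, ha, hb]
  refine (Finset.sum_le_sum hj).trans ?_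
  rw [Finset.sum_add_distrib, ← Finset.mul_sum, ← Finset.mul_sum, ← Finset.sum_mul,
    ← Finset.sum_mul]
  have e1 := sum_sum_lacunary_le hΛ h0 h1 h2 (c := fun n => a n ^ 2) (fun n => sq_nonneg _) L N
  have e2 := sum_sum_lacunary_le hΛ h0 h1 h2 (c := fun n => b n ^ 2) (fun n => sq_nonneg _) L N
  calc _ ≤ 2 * ((2 / (ratio Λ - 1) * A) * B) + 2 * ((2 / (ratio Λ - 1) * B) * A) := by
        gcongr
    _ = _ := by ring

/-- Paley's inequality for analytic polynomials with values in a finite-dimensional Hilbert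
space. -/
theorem sum_sq_coeff_le_of_polynomial {ι : Type*} [Fintype ι] {Λ : ℕ → ℕ} (hΛ : StrictMono Λ)
    (h0 : 0 < Λ 0) (h1 : 1 < ratio Λ) (h2 : ratio Λ < 2) (f : ι → Polynomial ℂ) (L : ℕ) :
    ∑ i, ∑ j ∈ Finset.range L, ‖(f i).coeff (Λ j)‖ ^ 2 ≤
      8 / (ratio Λ - 1) *
        (∫ x, Real.sqrt (∑ i, ‖(f i).eval (fourier 1 x : ℂ)‖ ^ 2) ∂μT) ^ 2 := by
  set v : Tor → ℝ := fun x => Real.sqrt (∑ i, ‖(f i).eval (fourier 1 x : ℂ)‖ ^ 2) with hv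
  have hvc : Continuous v := by fun_prop
  set I := ∫ x, v x ∂μT with hI
  have hρ : 0 < ratio Λ - 1 := by linarith
  have hv0 : ∀ x, 0 ≤ v x := fun x => Real.sqrt_nonneg _
  have hI0 : 0 ≤ I := integral_nonneg hv0
  set η : ℕ → ℝ := fun n => 1 / ((n : ℝ) + 1) with hη
  have hη0 : ∀ n, 0 < η n := fun n => by positivity
  have hηlim : Filter.Tendsto η Filter.atTop (nhds 0) := tendsto_one_div_add_atTop_nhds_zero_nat
  choose q r hqr using fun n => exists_approx_outer (w := fun x => v x + η n)
    (by fun_prop) (fun x => add_pos_of_nonneg_of_pos (hv0 x) (hη0 n)) (hη0 n)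
  have hbd : ∀ n, ∑ i, ∑ j ∈ Finset.range L, ‖(q n * (r n * f i)).coeff (Λ j)‖ ^ 2 ≤
      8 / (ratio Λ - 1) * (((1 + η n) * Real.exp (η n)) ^ 2 * (I + η n)) *
        (((1 + η n) * Real.exp (η n)) ^ 2 * (I + η n)) := by
    intro n
    set c := ((1 + η n) * Real.exp (η n)) ^ 2
    have hw : ∫ x, c * (v x + η n) ∂μT = c * (I + η n) := by
      rw [integral_const_mul, integral_add (integrable_of_continuous_circle hvc)
        (integrable_const _)]
      simp [hI]
    refine (sum_sq_coeff_mul_le hΛ h0 h1 h2 (q n) (fun i => r n * f i) L).trans ?_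
    refine mul_le_mul (mul_le_mul_of_nonneg_left ?_ (by positivity)) ?_
      (Finset.sum_nonneg fun i _ => integral_nonneg fun x => sq_nonneg _) ?_
    · rw [← hw]
      exact integral_mono (integrable_of_continuous_circle (by fun_prop))
        (integrable_of_continuous_circle (by fun_prop)) fun x => (hqr n x).2.1
    · rw [← hw, ← integral_finsetSum _ fun i _ =>
        integrable_of_continuous_circle (by fun_prop)]
      refine integral_mono (integrable_of_continuous_circle (by fun_prop))
        (integrable_of_continuous_circle (by fun_prop)) fun x => ?_
      simp only [Polynomial.eval_mul, norm_mul, mul_pow]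
      rw [← Finset.mul_sum]
      have hs : ∑ i, ‖(f i).eval (fourier 1 x : ℂ)‖ ^ 2 = v x ^ 2 :=
        (Real.sq_sqrt (Finset.sum_nonneg fun _ _ => sq_nonneg _)).symm
      rw [hs]
      have h3 := (hqr n x).2.2
      have h4 : v x ^ 2 ≤ (v x + η n) * (v x + η n) := by
        nlinarith [hv0 x, hη0 n]
      calc _ ≤ ‖(r n).eval (fourier 1 x : ℂ)‖ ^ 2 * ((v x + η n) * (v x + η n)) := by gcongr
        _ = ‖(r n).eval (fourier 1 x : ℂ)‖ ^ 2 * (v x + η n) * (v x + η n) := by ring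
        _ ≤ c * (v x + η n) := by
          gcongr
    · have := hη0 n
      positivity
  have hlim : ∀ i j, Filter.Tendsto (fun n => (q n * (r n * f i)).coeff (Λ j)) Filter.atTop
      (nhds ((f i).coeff (Λ j))) := by
    intro i j
    have hfc : Continuous fun x : Tor => ‖(f i).eval (fourier 1 x : ℂ)‖ := by fun_prop
    obtain ⟨S, hS⟩ := (isCompact_range hfc).bddAbove
    have hS : ∀ x : Tor, ‖(f i).eval (fourier 1 x : ℂ)‖ ≤ S := fun x => hS ⟨x, rfl⟩
    rw [tendsto_iff_norm_sub_tendsto_zero]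
    have hz : Filter.Tendsto (fun n => (2 * η n + η n ^ 2) * S) Filter.atTop (nhds 0) := by
      have := ((hηlim.const_mul 2).add (hηlim.pow 2)).mul_const S
      simpa using this
    refine squeeze_zero (fun _ => norm_nonneg _) (fun n => ?_) hz
    rw [← Polynomial.coeff_sub]
    refine norm_coeff_le_of_norm_eval_le _ _ fun x => ?_
    have : (q n * (r n * f i) - f i).eval (fourier 1 x : ℂ) =
        ((q n * r n).eval (fourier 1 x : ℂ) - 1) * (f i).eval (fourier 1 x : ℂ) := by
      simp only [Polynomial.eval_sub, Polynomial.eval_mul]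
      ring
    rw [this, norm_mul]
    exact mul_le_mul (hqr n x).1 (hS x) (norm_nonneg _) (by have := hη0 n; positivity)
  have hL : Filter.Tendsto
      (fun n => ∑ i, ∑ j ∈ Finset.range L, ‖(q n * (r n * f i)).coeff (Λ j)‖ ^ 2) Filter.atTop
      (nhds (∑ i, ∑ j ∈ Finset.range L, ‖(f i).coeff (Λ j)‖ ^ 2)) :=
    tendsto_finsetSum _ fun i _ => tendsto_finsetSum _ fun j _ => (hlim i j).norm.pow 2
  have hcont : Continuous fun e : ℝ =>
      8 / (ratio Λ - 1) * (((1 + e) * Real.exp e) ^ 2 * (I + e)) *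
        (((1 + e) * Real.exp e) ^ 2 * (I + e)) := by fun_prop
  have hR := (hcont.tendsto 0).comp hηlim
  have h3 := le_of_tendsto_of_tendsto' hL hR hbd
  simp only [add_zero, Real.exp_zero, mul_one, one_pow, one_mul] at h3
  linarith

instance (d : ℕ) : IsProbabilityMeasure (haarTd d) := by
  unfold haarTd; infer_instance

theorem integrable_of_continuous_torus {d : ℕ} {E : Type*} [NormedAddCommGroup E]
    {g : (Fin d → Tor) → E} (hg : Continuous g) : Integrable g (haarTd d) :=
  hg.integrable_of_hasCompactSupport (HasCompactSupport.of_compactSpace _)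

theorem continuous_mvPolynomial_eval_fourier {d : ℕ} (p : MvPolynomial (Fin d) ℂ) :
    Continuous fun x : Fin d → Tor => MvPolynomial.eval (fun k => (fourier 1 (x k) : ℂ)) p := by
  have : Continuous fun x : Fin d → Tor => (fun k => (fourier 1 (x k) : ℂ)) := by fun_prop
  exact (MvPolynomial.continuous_eval p).comp this

theorem integral_haarTd_succ {d : ℕ} {g : (Fin (d + 1) → Tor) → ℝ} (hg : Continuous g) :
    ∫ x, g x ∂(haarTd (d + 1)) = ∫ y, ∫ t, g (Fin.cons t y) ∂μT ∂(haarTd d) := by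
  have h := ((measurePreserving_piFinSuccAbove (fun _ : Fin (d + 1) => μT) 0).symm).integral_comp' g
  have hc : Continuous fun z : Tor × (Fin d → Tor) => g (Fin.cons z.1 z.2) := by
    refine hg.comp (continuous_pi fun k => ?_)
    refine Fin.cases ?_ (fun k => ?_) k
    · simpa using continuous_fst
    · simpa [Function.comp_def] using (continuous_apply k).comp continuous_snd
  have hi : Integrable (fun z : Tor × (Fin d → Tor) => g (Fin.cons z.1 z.2))
      (Measure.prod μT (haarTd d)) :=
    hc.integrable_of_hasCompactSupport (HasCompactSupport.of_compactSpace _)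
  rw [← integral_prod_symm _ hi]
  refine h.symm.trans (integral_congr_ae (ae_of_all _ fun z => ?_))
  simp [MeasurableEquiv.piFinSuccAbove, Fin.insertNthEquiv]

/-- The multi-parameter Paley inequality for families of analytic polynomials. -/
theorem sum_sq_coeff_le_of_mvPolynomial (d : ℕ) (Λs : Fin d → ℕ → ℕ)
    (hΛ : ∀ n, StrictMono (Λs n)) (h0 : ∀ n, 0 < Λs n 0) (h1 : ∀ n, 1 < ratio (Λs n))
    (h2 : ∀ n, ratio (Λs n) < 2) (L : ℕ) {ι : Type} [Fintype ι]
    (f : ι → MvPolynomial (Fin d) ℂ) :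
    ∑ i, ∑ j : Fin d → Fin L,
        ‖(f i).coeff (Finsupp.equivFunOnFinite.symm fun k => Λs k (j k))‖ ^ 2 ≤
      (∏ n, 8 / (ratio (Λs n) - 1)) *
        (∫ x, Real.sqrt (∑ i, ‖MvPolynomial.eval (fun k => (fourier 1 (x k) : ℂ)) (f i)‖ ^ 2)
          ∂(haarTd d)) ^ 2 := by
  induction d generalizing ι with
  | zero =>
    have he : ∀ i, ∀ x : Fin 0 → Tor,
        MvPolynomial.eval (fun k => (fourier 1 (x k) : ℂ)) (f i) = (f i).coeff 0 := by
      intro i x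
      conv_lhs => rw [MvPolynomial.eq_C_of_isEmpty (f i), MvPolynomial.eval_C]
    simp only [he, Finset.univ_eq_empty, Finset.prod_empty, one_mul, integral_const,
      probReal_univ, one_smul, Finset.univ_unique, Finset.sum_singleton]
    rw [Real.sq_sqrt (Finset.sum_nonneg fun _ _ => sq_nonneg _)]
    refine le_of_eq (Finset.sum_congr rfl fun i _ => ?_)
    congr 3
    exact Subsingleton.elim _ _
  | succ d ih =>
    set v : (Fin (d + 1) → Tor) → ℝ := fun x =>
      Real.sqrt (∑ i, ‖MvPolynomial.eval (fun k => (fourier 1 (x k) : ℂ)) (f i)‖ ^ 2) with hv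
    have hvc : Continuous v := by
      refine Continuous.sqrt (continuous_finsetSum _ fun i _ => ?_)
      exact (continuous_mvPolynomial_eval_fourier (f i)).norm.pow 2
    set K := 8 / (ratio (Λs 0) - 1) with hK
    have hK0 : 0 ≤ K := div_nonneg (by norm_num) (by linarith [h1 0])
    set g : ι × Fin L → MvPolynomial (Fin d) ℂ := fun a =>
      (MvPolynomial.finSuccEquiv ℂ d (f a.1)).coeff (Λs 0 a.2) with hg
    have ih' := ih (fun n => Λs n.succ) (fun n => hΛ _) (fun n => h0 _) (fun n => h1 _)
      (fun n => h2 _) g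
    have hsum : ∑ i, ∑ j : Fin (d + 1) → Fin L,
        ‖(f i).coeff (Finsupp.equivFunOnFinite.symm fun k => Λs k (j k))‖ ^ 2 =
        ∑ a, ∑ j : Fin d → Fin L,
        ‖(g a).coeff (Finsupp.equivFunOnFinite.symm fun k => Λs k.succ (j k))‖ ^ 2 := by
      rw [Fintype.sum_prod_type]
      refine Finset.sum_congr rfl fun i _ => ?_
      rw [← (Fin.consEquiv fun _ => Fin L).sum_comp, Fintype.sum_prod_type]
      refine Finset.sum_congr rfl fun j₀ _ => Finset.sum_congr rfl fun j _ => ?_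
      rw [hg]
      simp only [MvPolynomial.finSuccEquiv_coeff_coeff]
      congr 3
      ext k
      refine Fin.cases ?_ (fun k => ?_) k <;> simp
    have hpt : ∀ y : Fin d → Tor,
        Real.sqrt (∑ a, ‖MvPolynomial.eval (fun k => (fourier 1 (y k) : ℂ)) (g a)‖ ^ 2) ≤
          Real.sqrt K * ∫ t, v (Fin.cons t y) ∂μT := by
      intro y
      have h := sum_sq_coeff_le_of_polynomial (hΛ 0) (h0 0) (h1 0) (h2 0)
        (fun i => (MvPolynomial.finSuccEquiv ℂ d (f i)).map
          (MvPolynomial.eval fun k => (fourier 1 (y k) : ℂ))) L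
      have hcons : ∀ t : Tor, (fun k => (fourier 1 ((Fin.cons t y : Fin (d + 1) → Tor) k) : ℂ)) =
          Fin.cons (fourier 1 t : ℂ) (fun k => (fourier 1 (y k) : ℂ)) := by
        intro t
        ext k
        refine Fin.cases ?_ (fun k => ?_) k <;> simp
      simp only [← MvPolynomial.eval_eq_eval_mv_eval', ← hcons, Polynomial.coeff_map,
        Finset.sum_range] at h
      rw [← Fintype.sum_prod_type'] at h
      have h' := Real.sqrt_le_sqrt h
      rw [Real.sqrt_mul hK0, Real.sqrt_sq (integral_nonneg fun _ => Real.sqrt_nonneg _)] at h'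
      exact h'
    rw [hsum, integral_haarTd_succ hvc, Fin.prod_univ_succ]
    have hvint : Integrable (fun y : Fin d → Tor => ∫ t, v (Fin.cons t y) ∂μT) (haarTd d) := by
      have hc : Continuous fun z : (Fin d → Tor) × Tor => v (Fin.cons z.2 z.1) := by
        refine hvc.comp (continuous_pi fun k => ?_)
        refine Fin.cases ?_ (fun k => ?_) k
        · simpa using continuous_snd
        · simpa [Function.comp_def] using (continuous_apply k).comp continuous_fst
      have hi : Integrable (fun z : (Fin d → Tor) × Tor => v (Fin.cons z.2 z.1))
          ((haarTd d).prod μT) :=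
        hc.integrable_of_hasCompactSupport (HasCompactSupport.of_compactSpace _)
      exact hi.integral_prod_left
    have hmono : ∫ y, Real.sqrt (∑ a,
          ‖MvPolynomial.eval (fun k => (fourier 1 (y k) : ℂ)) (g a)‖ ^ 2) ∂(haarTd d) ≤
        Real.sqrt K * ∫ y, ∫ t, v (Fin.cons t y) ∂μT ∂(haarTd d) := by
      rw [← integral_const_mul]
      refine integral_mono (integrable_of_continuous_torus ?_) (hvint.const_mul _) hpt
      refine Continuous.sqrt (continuous_finsetSum _ fun a _ => ?_)
      exact (continuous_mvPolynomial_eval_fourier (g a)).norm.pow 2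
    have hprod : 0 ≤ ∏ n : Fin d, 8 / (ratio (Λs n.succ) - 1) :=
      Finset.prod_nonneg fun n _ => div_nonneg (by norm_num) (by linarith [h1 n.succ])
    refine ih'.trans ?_
    refine (mul_le_mul_of_nonneg_left (pow_le_pow_left₀
      (integral_nonneg fun _ => Real.sqrt_nonneg _) hmono 2) hprod).trans (le_of_eq ?_)
    rw [mul_pow, Real.sq_sqrt hK0]
    ring

/-- The character `x ↦ e^{i(n₁x₁+⋯+n_dx_d)}` of the `d`-torus. -/
def torusChar {d : ℕ} (n : Fin d → ℤ) (x : Fin d → Tor) : ℂ := ∏ k, (fourier (n k) (x k) : ℂ)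

theorem continuous_torusChar {d : ℕ} (n : Fin d → ℤ) : Continuous (torusChar n) := by
  unfold torusChar; fun_prop

theorem norm_torusChar {d : ℕ} (n : Fin d → ℤ) (x : Fin d → Tor) : ‖torusChar n x‖ = 1 := by
  rw [torusChar, norm_prod]
  exact Finset.prod_eq_one fun k _ => norm_fourier_apply _ _

theorem torusChar_sub {d : ℕ} (m n : Fin d → ℤ) (x : Fin d → Tor) :
    torusChar (m - n) x = torusChar m x * starRingEnd ℂ (torusChar n x) := by
  simp only [torusChar, map_prod, ← Finset.prod_mul_distrib, ← fourier_neg, ← fourier_add,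
    Pi.sub_apply, sub_eq_add_neg]

theorem torusChar_neg {d : ℕ} (n : Fin d → ℤ) (x : Fin d → Tor) :
    torusChar (-n) x = starRingEnd ℂ (torusChar n x) := by
  simp only [torusChar, map_prod, ← fourier_neg, Pi.neg_apply]

theorem integral_torusChar {d : ℕ} (n : Fin d → ℤ) :
    ∫ x, torusChar n x ∂(haarTd d) = if n = 0 then 1 else 0 := by
  unfold torusChar haarTd
  rw [integral_fintype_prod_eq_prod (fun k (t : Tor) => (fourier (n k) t : ℂ))]
  simp_rw [integral_fourier]
  split_ifs with h
  · simp [h]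
  · obtain ⟨k, hk⟩ := Function.ne_iff.1 h
    exact Finset.prod_eq_zero (Finset.mem_univ k) (if_neg hk)

/-- The Dirichlet-type kernel of a finite set of frequencies. -/
def torusKernel {d : ℕ} (B : Finset (Fin d → ℤ)) (x y : Fin d → Tor) : ℂ :=
  ∑ m ∈ B, torusChar m x * starRingEnd ℂ (torusChar m y)

theorem continuous_torusKernel {d : ℕ} (B : Finset (Fin d → ℤ)) :
    Continuous fun z : (Fin d → Tor) × (Fin d → Tor) => torusKernel B z.1 z.2 := by
  unfold torusKernel
  refine continuous_finsetSum _ fun m _ => ?_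
  exact ((continuous_torusChar m).comp continuous_fst).mul
    (Complex.continuous_conj.comp ((continuous_torusChar m).comp continuous_snd))

theorem sq_norm_torusKernel {d : ℕ} (B : Finset (Fin d → ℤ)) (x y : Fin d → Tor) :
    ((‖torusKernel B x y‖ ^ 2 : ℝ) : ℂ) =
      ∑ m ∈ B, ∑ n ∈ B, torusChar (m - n) x * torusChar (-(m - n)) y := by
  push_cast
  rw [← Complex.mul_conj', torusKernel, map_sum, Finset.sum_mul_sum]
  refine Finset.sum_congr rfl fun m _ => Finset.sum_congr rfl fun n _ => ?_
  rw [torusChar_neg, torusChar_sub, torusChar_sub]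
  simp only [map_mul, Complex.conj_conj]
  ring

theorem integral_sq_norm_torusKernel {d : ℕ} (B : Finset (Fin d → ℤ)) (y : Fin d → Tor) :
    ∫ x, ‖torusKernel B x y‖ ^ 2 ∂(haarTd d) = B.card := by
  have hc : ((∫ x, ‖torusKernel B x y‖ ^ 2 ∂(haarTd d) : ℝ) : ℂ) = ((B.card : ℝ) : ℂ) := by
    rw [← integral_complex_ofReal]
    simp_rw [sq_norm_torusKernel]
    rw [integral_finsetSum _ fun m _ => integrable_finsetSum _ fun n _ =>
      (integrable_of_continuous_torus (continuous_torusChar _)).mul_const _]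
    simp_rw [integral_finsetSum _ fun n _ =>
      (integrable_of_continuous_torus (continuous_torusChar _)).mul_const _,
      integral_mul_const, integral_torusChar, sub_eq_zero]
    simp +contextual [torusChar]
  exact_mod_cast hc

theorem fourierCoeffPi_eq {d : ℕ} (f : (Fin d → Tor) → ℂ) (n : Fin d → ℤ) :
    fourierCoeffPi f n = ∫ x, torusChar (-n) x * f x ∂(haarTd d) := rfl

theorem sum_torusChar_mul_fourierCoeffPi {d : ℕ} (B : Finset (Fin d → ℤ))
    {f : (Fin d → Tor) → ℂ} (hf : Integrable f (haarTd d)) (x : Fin d → Tor) :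
    ∑ m ∈ B, ∑ n ∈ B, torusChar (m - n) x * fourierCoeffPi f (m - n) =
      ∫ y, ((‖torusKernel B x y‖ ^ 2 : ℝ) : ℂ) * f y ∂(haarTd d) := by
  have hi : ∀ n : Fin d → ℤ, Integrable (fun y => torusChar n y * f y) (haarTd d) := fun n =>
    hf.bdd_mul (c := 1) (continuous_torusChar n).aestronglyMeasurable
      (ae_of_all _ fun y => (norm_torusChar n y).le)
  simp_rw [sq_norm_torusKernel, Finset.sum_mul, mul_assoc]
  rw [integral_finsetSum _ fun m _ => integrable_finsetSum _ fun n _ => (hi _).const_mul _]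
  refine Finset.sum_congr rfl fun m _ => ?_
  rw [integral_finsetSum _ fun n _ => (hi _).const_mul _]
  refine Finset.sum_congr rfl fun n _ => ?_
  rw [integral_const_mul, fourierCoeffPi_eq]

theorem integral_norm_sum_torusChar_le {d : ℕ} (B : Finset (Fin d → ℤ))
    {f : (Fin d → Tor) → ℂ} (hf : Integrable f (haarTd d)) :
    ∫ x, ‖∑ m ∈ B, ∑ n ∈ B, torusChar (m - n) x * fourierCoeffPi f (m - n)‖ ∂(haarTd d) ≤
      B.card * ∫ y, ‖f y‖ ∂(haarTd d) := by
  have hK : Continuous fun z : (Fin d → Tor) × (Fin d → Tor) => ‖torusKernel B z.1 z.2‖ ^ 2 :=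
    (continuous_torusKernel B).norm.pow 2
  obtain ⟨M, hM⟩ := (isCompact_range hK).bddAbove
  have hKf : Integrable (fun z : (Fin d → Tor) × (Fin d → Tor) =>
      ‖torusKernel B z.1 z.2‖ ^ 2 * ‖f z.2‖) ((haarTd d).prod (haarTd d)) := by
    refine (hf.norm.comp_snd (haarTd d)).bdd_mul (c := M) hK.aestronglyMeasurable
      (ae_of_all _ fun z => ?_)
    rw [Real.norm_of_nonneg (sq_nonneg _)]
    exact hM ⟨z, rfl⟩
  calc _ ≤ ∫ x, ∫ y, ‖torusKernel B x y‖ ^ 2 * ‖f y‖ ∂(haarTd d) ∂(haarTd d) := by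
        refine integral_mono (integrable_of_continuous_torus ?_) hKf.integral_prod_left
          fun x => ?_
        · exact (continuous_finsetSum _ fun m _ => continuous_finsetSum _ fun n _ =>
            (continuous_torusChar _).mul continuous_const).norm
        · simp only
          rw [sum_torusChar_mul_fourierCoeffPi B hf]
          refine (norm_integral_le_integral_norm _).trans (le_of_eq ?_)
          refine integral_congr_ae (ae_of_all _ fun y => ?_)
          simp
    _ = ∫ y, ∫ x, ‖torusKernel B x y‖ ^ 2 * ‖f y‖ ∂(haarTd d) ∂(haarTd d) :=
        integral_integral_swap hKf
    _ = _ := by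
        simp_rw [integral_mul_const, integral_sq_norm_torusKernel]
        rw [integral_const_mul]

open Classical in
/-- The Fejér mean of an analytic function on the `d`-torus, scaled by `N ^ d`, as a polynomial. -/
def fejerPoly {d : ℕ} (f : (Fin d → Tor) → ℂ) (N : ℕ) : MvPolynomial (Fin d) ℂ :=
  ∑ m ∈ Fintype.piFinset fun _ : Fin d => Finset.range N,
    ∑ n ∈ Fintype.piFinset fun _ : Fin d => Finset.range N,
      if n ≤ m then MvPolynomial.monomial (Finsupp.equivFunOnFinite.symm (m - n))
        (fourierCoeffPi f fun k => (m k : ℤ) - n k) else 0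

theorem coeff_fejerPoly {d : ℕ} (f : (Fin d → Tor) → ℂ) (N : ℕ) (ν : Fin d → ℕ) :
    (fejerPoly f N).coeff (Finsupp.equivFunOnFinite.symm ν) =
      (∏ k, ((N - ν k : ℕ) : ℂ)) * fourierCoeffPi f fun k => (ν k : ℤ) := by
  classical
  have h : ∀ m n : Fin d → ℕ, (if n ≤ m then MvPolynomial.monomial
        (Finsupp.equivFunOnFinite.symm (m - n))
        (fourierCoeffPi f fun k => (m k : ℤ) - n k) else 0).coeff
        (Finsupp.equivFunOnFinite.symm ν) =
      if m = n + ν then fourierCoeffPi f fun k => (ν k : ℤ) else 0 := by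
    intro m n
    by_cases hm : m = n + ν
    · subst hm
      simp
    · rw [if_neg hm]
      split_ifs with hnm
      · rw [MvPolynomial.coeff_monomial, if_neg]
        intro he
        apply hm
        rw [← Finsupp.equivFunOnFinite.symm.injective he, add_tsub_cancel_of_le hnm]
      · simp
  rw [fejerPoly, Finset.sum_comm]
  simp only [MvPolynomial.coeff_sum, h, Finset.sum_ite_eq']
  rw [← Finset.sum_filter, Finset.sum_const, nsmul_eq_mul]
  congr 1
  have hcard : (Fintype.piFinset fun _ : Fin d => Finset.range N).filter
      (fun n => n + ν ∈ Fintype.piFinset fun _ : Fin d => Finset.range N) =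
      Fintype.piFinset fun k => Finset.range (N - ν k) := by
    ext n
    simp only [Finset.mem_filter, Fintype.mem_piFinset, Finset.mem_range, Pi.add_apply]
    exact ⟨fun h k => by have := h.2 k; omega,
      fun h => ⟨fun k => by have := h k; omega, fun k => by have := h k; omega⟩⟩
  rw [hcard, Fintype.card_piFinset]
  simp

theorem eval_fejerPoly {d : ℕ} {f : (Fin d → Tor) → ℂ}
    (hA : ∀ m : Fin d → ℤ, (∃ k, m k < 0) → fourierCoeffPi f m = 0) (N : ℕ) (x : Fin d → Tor) :
    MvPolynomial.eval (fun k => (fourier 1 (x k) : ℂ)) (fejerPoly f N) =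
      ∑ m ∈ (Fintype.piFinset fun _ : Fin d => Finset.range N).image fun m k => (m k : ℤ),
        ∑ n ∈ (Fintype.piFinset fun _ : Fin d => Finset.range N).image fun m k => (m k : ℤ),
          torusChar (m - n) x * fourierCoeffPi f (m - n) := by
  have hinj : Function.Injective fun (m : Fin d → ℕ) (k : Fin d) => (m k : ℤ) := by
    intro m n h
    ext k
    simpa using congrFun h k
  rw [Finset.sum_image hinj.injOn, fejerPoly, map_sum]
  refine Finset.sum_congr rfl fun m _ => ?_
  rw [Finset.sum_image hinj.injOn, map_sum]
  refine Finset.sum_congr rfl fun n _ => ?_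
  change _ = _ * fourierCoeffPi f fun k => (m k : ℤ) - n k
  split_ifs with h
  · rw [MvPolynomial.eval_monomial, mul_comm, Finsupp.prod_fintype _ _ fun _ => pow_zero _]
    congr 1
    refine Finset.prod_congr rfl fun k _ => ?_
    rw [fourier_one_pow]
    simp [Nat.cast_sub (h k)]
  · rw [map_zero, hA, mul_zero]
    obtain ⟨k, hk⟩ := not_forall.1 h
    exact ⟨k, sub_neg.2 (Nat.cast_lt.2 (not_le.1 hk))⟩

theorem integral_norm_eval_fejerPoly_le {d : ℕ} {f : (Fin d → Tor) → ℂ}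
    (hf : Integrable f (haarTd d))
    (hA : ∀ m : Fin d → ℤ, (∃ k, m k < 0) → fourierCoeffPi f m = 0) (N : ℕ) :
    ∫ x, ‖MvPolynomial.eval (fun k => (fourier 1 (x k) : ℂ)) (fejerPoly f N)‖ ∂(haarTd d) ≤
      (N : ℝ) ^ d * ∫ y, ‖f y‖ ∂(haarTd d) := by
  simp_rw [eval_fejerPoly hA]
  refine (integral_norm_sum_torusChar_le _ hf).trans ?_
  refine mul_le_mul_of_nonneg_right ?_ (integral_nonneg fun _ => norm_nonneg _)
  have := Finset.card_image_le (s := Fintype.piFinset fun _ : Fin d => Finset.range N)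
    (f := fun m k => (m k : ℤ))
  rw [Fintype.card_piFinset] at this
  simp only [Finset.card_range, Finset.prod_const, Finset.card_univ, Fintype.card_fin] at this
  exact_mod_cast this

theorem tendsto_natCast_sub_div (ν : ℕ) :
    Filter.Tendsto (fun N : ℕ => ((N - ν : ℕ) : ℝ) / N) Filter.atTop (nhds 1) := by
  have h : Filter.Tendsto (fun N : ℕ => 1 - (ν : ℝ) / N) Filter.atTop (nhds (1 - 0)) :=
    tendsto_const_nhds.sub (tendsto_const_div_atTop_nhds_zero_nat _)
  rw [sub_zero] at h
  refine h.congr' ?_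
  filter_upwards [Filter.eventually_ge_atTop (ν + 1)] with N hN
  have : (N : ℝ) ≠ 0 := by
    have : 0 < N := by omega
    positivity
  rw [Nat.cast_sub (by omega)]
  field_simp

theorem sum_sq_fourierCoeffPi_le {d : ℕ} (Λs : Fin d → ℕ → ℕ)
    (hΛ : ∀ n, StrictMono (Λs n)) (h0 : ∀ n, 0 < Λs n 0) (h1 : ∀ n, 1 < ratio (Λs n))
    (h2 : ∀ n, ratio (Λs n) < 2) {f : (Fin d → Tor) → ℂ} (hf : Integrable f (haarTd d))
    (hA : ∀ m : Fin d → ℤ, (∃ k, m k < 0) → fourierCoeffPi f m = 0) (L : ℕ) :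
    ∑ j : Fin d → Fin L, ‖fourierCoeffPi f (fun k => (Λs k (j k) : ℤ))‖ ^ 2 ≤
      (∏ n, 8 / (ratio (Λs n) - 1)) * (∫ x, ‖f x‖ ∂(haarTd d)) ^ 2 := by
  have hprod : 0 ≤ ∏ n : Fin d, 8 / (ratio (Λs n) - 1) :=
    Finset.prod_nonneg fun n _ => div_nonneg (by norm_num) (by linarith [h1 n])
  have hN : ∀ N : ℕ, 0 < N → ∑ j : Fin d → Fin L, ((∏ k, ((N - Λs k (j k) : ℕ) : ℝ) / N) *
      ‖fourierCoeffPi f (fun k => (Λs k (j k) : ℤ))‖) ^ 2 ≤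
      (∏ n, 8 / (ratio (Λs n) - 1)) * (∫ x, ‖f x‖ ∂(haarTd d)) ^ 2 := by
    intro N hN
    have hN' : (0 : ℝ) < (N : ℝ) ^ d := by positivity
    have h := sum_sq_coeff_le_of_mvPolynomial d Λs hΛ h0 h1 h2 L fun _ : Unit => fejerPoly f N
    simp only [Finset.univ_unique, Finset.sum_singleton, Real.sqrt_sq (norm_nonneg _),
      coeff_fejerPoly, norm_mul, norm_prod, Complex.norm_natCast] at h
    have h' := h.trans (mul_le_mul_of_nonneg_left (pow_le_pow_left₀
      (integral_nonneg fun _ => norm_nonneg _) (integral_norm_eval_fejerPoly_le hf hA N) 2) hprod)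
    simp only [Finset.prod_div_distrib, Finset.prod_const, Finset.card_univ, Fintype.card_fin,
      div_mul_eq_mul_div (_ : ℝ) ((N : ℝ) ^ d), div_pow _ ((N : ℝ) ^ d)] at h' ⊢
    rw [← Finset.sum_div, div_le_iff₀ (by positivity)]
    refine h'.trans (le_of_eq ?_)
    ring
  have hlim : Filter.Tendsto (fun N : ℕ => ∑ j : Fin d → Fin L,
      ((∏ k, ((N - Λs k (j k) : ℕ) : ℝ) / N) *
        ‖fourierCoeffPi f (fun k => (Λs k (j k) : ℤ))‖) ^ 2) Filter.atTop
      (nhds (∑ j : Fin d → Fin L, ((∏ _k : Fin d, (1 : ℝ)) *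
        ‖fourierCoeffPi f (fun k => (Λs k (j k) : ℤ))‖) ^ 2)) :=
    tendsto_finsetSum _ fun j _ => ((tendsto_finsetProd _ fun k _ =>
      tendsto_natCast_sub_div _).mul_const _).pow 2
  simp only [Finset.prod_const_one, one_mul] at hlim
  refine le_of_tendsto hlim ?_
  filter_upwards [Filter.eventually_gt_atTop 0] with N hN0
  exact hN N hN0

theorem sum_finset_sq_fourierCoeffPi_le {d : ℕ} (Λs : Fin d → ℕ → ℕ)
    (hΛ : ∀ n, StrictMono (Λs n)) (h0 : ∀ n, 0 < Λs n 0) (h1 : ∀ n, 1 < ratio (Λs n))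
    (h2 : ∀ n, ratio (Λs n) < 2) {f : (Fin d → Tor) → ℂ} (hf : Integrable f (haarTd d))
    (hA : ∀ m : Fin d → ℤ, (∃ k, m k < 0) → fourierCoeffPi f m = 0)
    (s : Finset (Fin d → ℕ)) :
    ∑ j ∈ s, ‖fourierCoeffPi f (fun k => (Λs k (j k) : ℤ))‖ ^ 2 ≤
      (∏ n, 8 / (ratio (Λs n) - 1)) * (∫ x, ‖f x‖ ∂(haarTd d)) ^ 2 := by
  classical
  set L := s.sup (fun j => Finset.univ.sup j) + 1 with hL
  have hlt : ∀ j ∈ s, ∀ k, j k < L := fun j hj k => Nat.lt_succ_of_le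
    ((Finset.le_sup (f := j) (Finset.mem_univ k)).trans
      (Finset.le_sup (f := fun j : Fin d → ℕ => Finset.univ.sup j) hj))
  refine le_trans ?_ (sum_sq_fourierCoeffPi_le Λs hΛ h0 h1 h2 hf hA L)
  have hinj : Function.Injective fun (j : Fin d → Fin L) (k : Fin d) => (j k : ℕ) := by
    intro j j' h
    ext k
    exact congrFun h k
  rw [← Finset.sum_image (s := Finset.univ) (g := fun (j : Fin d → Fin L) (k : Fin d) => (j k : ℕ))
    (f := fun j => ‖fourierCoeffPi f (fun k => (Λs k (j k) : ℤ))‖ ^ 2) hinj.injOn]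
  refine Finset.sum_le_sum_of_subset_of_nonneg (fun j hj => ?_) fun _ _ _ => sq_nonneg _
  exact Finset.mem_image.2 ⟨fun k => ⟨j k, hlt j hj k⟩, Finset.mem_univ _, rfl⟩

/-- Multi-parameter Paley inequality: for every `d ≥ 1` there is `C_d > 0` such that for
all lacunary sequences `Λ₁, …, Λ_d` of positive integers with ratios in `(1,2)` and every
`f ∈ H¹_A(𝕋^d)`,
`(Σ_{j₁,…,j_d} |f̂(λ^{(1)}_{j₁},…,λ^{(d)}_{j_d})|²)^{1/2}
  ≤ C_d (Π_n (ρ_{Λ_n} - 1)^{-1/2}) ‖f‖_{L¹(𝕋^d)}`. -/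
theorem statement7 (d : ℕ) (hd : 0 < d) :
    ∃ C : ℝ, 0 < C ∧
      ∀ Λs : Fin d → ℕ → ℕ,
        (∀ n, StrictMono (Λs n)) → (∀ n, 0 < Λs n 0) →
        (∀ n, 1 < ratio (Λs n)) → (∀ n, ratio (Λs n) < 2) →
        ∀ f : (Fin d → Tor) → ℂ, Integrable f (haarTd d) →
          (∀ m : Fin d → ℤ, (∃ k, m k < 0) → fourierCoeffPi f m = 0) →
          Real.sqrt (∑' j : Fin d → ℕ, ‖fourierCoeffPi f (fun k => (Λs k (j k) : ℤ))‖ ^ 2) ≤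
            C * (∏ n, (ratio (Λs n) - 1) ^ (-(1:ℝ)/2)) * ∫ x, ‖f x‖ ∂(haarTd d) := by
  refine ⟨Real.sqrt 8 ^ d, by positivity, fun Λs hΛ h0 h1 h2 f hf hA => ?_⟩
  have hsum := Real.tsum_le_of_sum_le (f := fun j : Fin d → ℕ =>
    ‖fourierCoeffPi f (fun k => (Λs k (j k) : ℤ))‖ ^ 2) (fun _ => sq_nonneg _)
    (sum_finset_sq_fourierCoeffPi_le Λs hΛ h0 h1 h2 hf hA)
  refine (Real.sqrt_le_sqrt hsum).trans (le_of_eq ?_)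
  have hfac : ∀ n, 8 / (ratio (Λs n) - 1) =
      (Real.sqrt 8 * (ratio (Λs n) - 1) ^ (-(1:ℝ)/2)) ^ 2 := by
    intro n
    have hρ : 0 < ratio (Λs n) - 1 := by linarith [h1 n]
    rw [mul_pow, Real.sq_sqrt (by norm_num), ← Real.rpow_natCast (_ ^ _), ← Real.rpow_mul hρ.le,
      div_eq_mul_inv, ← Real.rpow_neg_one]
    norm_num
  simp_rw [hfac]
  rw [Finset.prod_pow, ← mul_pow, Real.sqrt_sq, Finset.prod_mul_distrib]
  · simp
  · refine mul_nonneg (Finset.prod_nonneg fun n _ => mul_nonneg (Real.sqrt_nonneg _)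
      (Real.rpow_nonneg ?_ _)) (integral_nonneg fun _ => norm_nonneg _)
    linarith [h1 n]

end
end
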